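/- arXiv:1010.1865 — 3 statements merged into one kernel-verified Lean document; each statement's English description precedes it below -/
import Mathlib

section
/- For every real β > -1 and all natural numbers n, l, the generalized Laguerre polynomials satisfy the orthogonality relation ∫₀^∞ x^β e^{-x} L_l^β(x) L_n^β(x) dx = Γ(1+β)·(Γ(n+β+1)/(Γ(β+1)·n!)) if n = l, and ∫₀^∞ x^β e^{-x} L_l^β(x) L_n^β(x) dx = 0 if n ≠ l. Equivalently, the integral equals Γ(1+β)·binom(n+β, n)·δ_{n,l}, where binom(n+β, n) = Γ(n+β+1)/(Γ(β+1)·Γ(n+1)). -/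
open Real MeasureTheory

/-- The generalized Laguerre polynomial
`L_n^μ(x) = ∑_{k=0}^{n} Γ(n+μ+1)/(Γ(μ+k+1)·(n-k)!) · (-x)^k / k!`. -/
noncomputable def genLaguerre (μ : ℝ) (n : ℕ) (x : ℝ) : ℝ :=
  ∑ k ∈ Finset.range (n + 1),
    Real.Gamma (n + μ + 1) / (Real.Gamma (μ + k + 1) * (Nat.factorial (n - k) : ℝ)) * ((-x) ^ k / (Nat.factorial k : ℝ))

open Finset in
/-- Alternating binomial sums of a shifted rising factorial of degree `j ≤ n`: they vanish for
`j < n`, and only the leading coefficient contributes for `j = n`. -/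
lemma sum_neg_one_pow_mul_choose_mul_ascPochhammer_eval {n j : ℕ} (hj : j ≤ n) (y : ℝ) :
    ∑ k ∈ range (n + 1), (-1 : ℝ) ^ k * n.choose k * (ascPochhammer ℝ j).eval (y + k) =
      if j = n then (-1) ^ n * (n.factorial : ℝ) else 0 := by
  have hΔ : ((fwdDiff (1 : ℝ))^[n] (ascPochhammer ℝ j).eval) y =
      if j = n then (n.factorial : ℝ) else 0 := by
    split_ifs with h
    · subst h
      have := congrFun (Polynomial.fwdDiff_iter_degree_eq_factorial (ascPochhammer ℝ j)) y
      rw [ascPochhammer_natDegree, (monic_ascPochhammer ℝ j).leadingCoeff] at this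
      simpa using this
    · exact congrFun (Polynomial.fwdDiff_iter_eq_zero_of_degree_lt
        (by rw [ascPochhammer_natDegree]; omega)) y
  rw [fwdDiff_iter_eq_sum_shift] at hΔ
  trans (-1) ^ n * (if j = n then (n.factorial : ℝ) else 0)
  · rw [← hΔ, mul_sum]
    refine sum_congr rfl fun k hk ↦ ?_
    obtain ⟨m, rfl⟩ := Nat.exists_eq_add_of_le (Nat.lt_succ_iff.mp (mem_range.mp hk))
    have hsq : (-1 : ℝ) ^ m * (-1) ^ m = 1 := by rw [← mul_pow]; norm_num
    simp only [zsmul_eq_mul, nsmul_eq_mul, mul_one, add_tsub_cancel_left, pow_add]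
    push_cast
    linear_combination (-((-1 : ℝ) ^ k * (k + m).choose k *
      (ascPochhammer ℝ j).eval (y + k))) * hsq
  · split_ifs <;> simp

lemma Real.Gamma_add_nat_eq_ascPochhammer_eval_mul {s : ℝ} (hs : 0 < s) (j : ℕ) :
    Real.Gamma (s + j) = (ascPochhammer ℝ j).eval s * Real.Gamma s := by
  induction j with
  | zero => simp
  | succ j ih =>
    rw [ascPochhammer_succ_eval, Nat.cast_succ, ← add_assoc, Real.Gamma_add_one (by positivity), ih]
    ring

lemma integrableOn_rpow_mul_exp_neg_mul_pow {β : ℝ} (hβ : -1 < β) (m : ℕ) :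
    IntegrableOn (fun x : ℝ ↦ x ^ β * Real.exp (-x) * x ^ m) (Set.Ioi 0) := by
  have hm : (0 : ℝ) ≤ m := m.cast_nonneg
  refine (Real.GammaIntegral_convergent (s := β + m + 1) (by linarith)).congr_fun
    (fun x hx ↦ ?_) measurableSet_Ioi
  simp only [add_sub_cancel_right]
  rw [Real.rpow_add hx, Real.rpow_natCast]
  ring

lemma integral_rpow_mul_exp_neg_mul_pow {β : ℝ} (hβ : -1 < β) (m : ℕ) :
    ∫ x in Set.Ioi (0 : ℝ), x ^ β * Real.exp (-x) * x ^ m = Real.Gamma (β + m + 1) := by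
  have hm : (0 : ℝ) ≤ m := m.cast_nonneg
  rw [Real.Gamma_eq_integral (by linarith)]
  refine setIntegral_congr_fun measurableSet_Ioi fun x hx ↦ ?_
  simp only [add_sub_cancel_right]
  rw [Real.rpow_add hx, Real.rpow_natCast]
  ring

/-- The coefficient of `x ^ k` in `genLaguerre μ n x`. -/
noncomputable def genLaguerreCoeff (μ : ℝ) (n k : ℕ) : ℝ :=
  Real.Gamma (n + μ + 1) / (Real.Gamma (μ + k + 1) * ((n - k).factorial : ℝ)) *
    ((-1) ^ k / (k.factorial : ℝ))

lemma genLaguerre_eq_sum (μ : ℝ) (n : ℕ) (x : ℝ) :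
    genLaguerre μ n x = ∑ k ∈ Finset.range (n + 1), genLaguerreCoeff μ n k * x ^ k := by
  refine Finset.sum_congr rfl fun k _ ↦ ?_
  rw [genLaguerreCoeff, neg_pow]
  ring

lemma rpow_mul_exp_neg_mul_pow_mul_genLaguerre (β : ℝ) (n j : ℕ) (x : ℝ) :
    x ^ β * Real.exp (-x) * x ^ j * genLaguerre β n x =
      ∑ k ∈ Finset.range (n + 1),
        genLaguerreCoeff β n k * (x ^ β * Real.exp (-x) * x ^ (k + j)) := by
  rw [genLaguerre_eq_sum, Finset.mul_sum]
  refine Finset.sum_congr rfl fun k _ ↦ ?_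
  rw [pow_add]
  ring

lemma integrableOn_pow_mul_genLaguerre {β : ℝ} (hβ : -1 < β) (n j : ℕ) :
    IntegrableOn (fun x : ℝ ↦ x ^ β * Real.exp (-x) * x ^ j * genLaguerre β n x)
      (Set.Ioi 0) := by
  simp only [rpow_mul_exp_neg_mul_pow_mul_genLaguerre]
  exact integrable_finsetSum _ fun k _ ↦
    (integrableOn_rpow_mul_exp_neg_mul_pow hβ (k + j)).const_mul _

/-- `L_n^β` is orthogonal to every `x ^ j` with `j < n`; the moment with `j = n` is explicit. -/
lemma integral_pow_mul_genLaguerre {β : ℝ} (hβ : -1 < β) {n j : ℕ} (hj : j ≤ n) :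
    ∫ x in Set.Ioi (0 : ℝ), x ^ β * Real.exp (-x) * x ^ j * genLaguerre β n x =
      if j = n then (-1) ^ n * Real.Gamma (n + β + 1) else 0 := by
  simp only [rpow_mul_exp_neg_mul_pow_mul_genLaguerre]
  rw [integral_finsetSum _ fun k _ ↦
    (integrableOn_rpow_mul_exp_neg_mul_pow hβ (k + j)).const_mul _]
  simp only [integral_const_mul, integral_rpow_mul_exp_neg_mul_pow hβ]
  have hterm : ∀ k ∈ Finset.range (n + 1),
      genLaguerreCoeff β n k * Real.Gamma (β + (k + j : ℕ) + 1) =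
        Real.Gamma (n + β + 1) / n.factorial *
          ((-1) ^ k * n.choose k * (ascPochhammer ℝ j).eval (β + 1 + k)) := by
    intro k hk
    have hk0 : (0 : ℝ) ≤ k := k.cast_nonneg
    have hpos : 0 < β + k + 1 := by linarith
    have hΓ := (Real.Gamma_pos_of_pos hpos).ne'
    rw [show β + (k + j : ℕ) + 1 = β + k + 1 + j by push_cast; ring,
      Real.Gamma_add_nat_eq_ascPochhammer_eval_mul hpos,
      Nat.cast_choose ℝ (Nat.lt_succ_iff.mp (Finset.mem_range.mp hk)), genLaguerreCoeff,
      add_right_comm β 1]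
    field_simp
  rw [Finset.sum_congr rfl hterm, ← Finset.mul_sum,
    sum_neg_one_pow_mul_choose_mul_ascPochhammer_eval hj]
  split_ifs
  · field_simp
  · simp

lemma integral_genLaguerre_mul_genLaguerre_of_le {β : ℝ} (hβ : -1 < β) {n l : ℕ} (hl : l ≤ n) :
    ∫ x in Set.Ioi (0 : ℝ), x ^ β * Real.exp (-x) * genLaguerre β l x * genLaguerre β n x =
      if l = n then Real.Gamma (n + β + 1) / n.factorial else 0 := by
  have hexpand (x : ℝ) :
      x ^ β * Real.exp (-x) * genLaguerre β l x * genLaguerre β n x =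
        ∑ j ∈ Finset.range (l + 1),
          genLaguerreCoeff β l j * (x ^ β * Real.exp (-x) * x ^ j * genLaguerre β n x) := by
    rw [genLaguerre_eq_sum β l, Finset.mul_sum, Finset.sum_mul]
    exact Finset.sum_congr rfl fun j _ ↦ by ring
  simp only [hexpand]
  rw [integral_finsetSum _ fun j _ ↦ (integrableOn_pow_mul_genLaguerre hβ n j).const_mul _]
  simp only [integral_const_mul]
  have hlower : ∀ j ∈ Finset.range l, genLaguerreCoeff β l j *
      ∫ x in Set.Ioi (0 : ℝ), x ^ β * Real.exp (-x) * x ^ j * genLaguerre β n x = 0 := by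
    intro j hj
    have hjn := (Finset.mem_range.mp hj).trans_le hl
    rw [integral_pow_mul_genLaguerre hβ hjn.le, if_neg hjn.ne, mul_zero]
  rw [Finset.sum_range_succ, Finset.sum_eq_zero hlower, zero_add,
    integral_pow_mul_genLaguerre hβ hl]
  split_ifs with h
  · subst h
    have hl0 : (0 : ℝ) ≤ l := l.cast_nonneg
    have hΓ := (Real.Gamma_pos_of_pos (show 0 < β + l + 1 by linarith)).ne'
    have hsq : (-1 : ℝ) ^ l * (-1) ^ l = 1 := by rw [← mul_pow]; norm_num
    rw [genLaguerreCoeff, add_comm (l : ℝ) β, Nat.sub_self, Nat.factorial_zero, Nat.cast_one,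
      mul_one, div_self hΓ]
    linear_combination (Real.Gamma (β + l + 1) / l.factorial) * hsq
  · simp

/-- Orthogonality of the generalized Laguerre polynomials with respect to the
weight `x^β e^{-x}` on `(0, ∞)`:
`∫₀^∞ x^β e^{-x} L_l^β(x) L_n^β(x) dx = Γ(1+β)·(Γ(n+β+1)/(Γ(β+1)·n!))` if `n = l`,
and `0` otherwise. -/
theorem genLaguerre_orthogonality (β : ℝ) (hβ : -1 < β) (n l : ℕ) :
    ∫ x in Set.Ioi (0 : ℝ),
        x ^ β * Real.exp (-x) * genLaguerre β l x * genLaguerre β n x =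
      if n = l then
        Real.Gamma (1 + β) * (Real.Gamma (n + β + 1) / (Real.Gamma (β + 1) * (Nat.factorial n : ℝ)))
      else 0 := by
  have hΓ := (Real.Gamma_pos_of_pos (show 0 < β + 1 by linarith)).ne'
  rw [add_comm 1 β]
  rcases le_total l n with h | h
  · rw [integral_genLaguerre_mul_genLaguerre_of_le hβ h]
    simp only [eq_comm (a := l)]
    split_ifs
    · field_simp
    · rfl
  · simp only [mul_right_comm _ (genLaguerre β l _)]
    rw [integral_genLaguerre_mul_genLaguerre_of_le hβ h]
    split_ifs with hnl
    · subst hnl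
      field_simp
    · rfl
end

section
/- For every real β > -1, every natural number n ≥ 1, and every x > 0, the derivative of the function x ↦ x^{β+1} e^{-x} L_{n-1}^{β+1}(x) equals n · x^{β} e^{-x} L_n^{β}(x). -/
open Real MeasureTheory

/-- The `k`-th summand of `genLaguerre μ n x`. -/
noncomputable def genLaguerreTerm (μ : ℝ) (n : ℕ) (x : ℝ) (k : ℕ) : ℝ :=
  Real.Gamma (n + μ + 1) / (Real.Gamma (μ + k + 1) * (Nat.factorial (n - k) : ℝ)) *
    ((-x) ^ k / (Nat.factorial k : ℝ))

theorem genLaguerre_eq_sum_genLaguerreTerm (μ : ℝ) (n : ℕ) (x : ℝ) :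
    genLaguerre μ n x = ∑ k ∈ Finset.range (n + 1), genLaguerreTerm μ n x k := rfl

theorem hasDerivAt_genLaguerreTerm (μ : ℝ) (n k : ℕ) {x : ℝ} (hx : x ≠ 0) :
    HasDerivAt (fun y => genLaguerreTerm μ n y k) (k * genLaguerreTerm μ n x k / x) x := by
  have h := (((hasDerivAt_id x).neg.pow k).div_const (Nat.factorial k : ℝ)).const_mul
    (Real.Gamma (n + μ + 1) / (Real.Gamma (μ + k + 1) * (Nat.factorial (n - k) : ℝ)))
  refine h.congr_deriv ?_
  unfold genLaguerreTerm
  cases k with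
  | zero => simp
  | succ k =>
    simp only [Pi.neg_apply, id, Nat.add_sub_cancel, pow_succ (-x) k]
    field_simp

theorem hasDerivAt_genLaguerre (μ : ℝ) (n : ℕ) {x : ℝ} (hx : x ≠ 0) :
    HasDerivAt (genLaguerre μ n)
      (∑ k ∈ Finset.range (n + 1), k * genLaguerreTerm μ n x k / x) x :=
  HasDerivAt.fun_sum fun k _ => hasDerivAt_genLaguerreTerm μ n k hx

theorem add_mul_genLaguerreTerm {β : ℝ} (hβ : -1 < β) {m k : ℕ} (hk : k ≤ m) (x : ℝ) :
    (β + 1 + k) * genLaguerreTerm (β + 1) m x k =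
      ((m + 1 : ℕ) - k : ℝ) * genLaguerreTerm β (m + 1) x k := by
  obtain ⟨j, rfl⟩ := Nat.exists_eq_add_of_le hk
  have hpos : 0 < β + k + 1 := by have : (0 : ℝ) ≤ k := k.cast_nonneg; linarith
  have hΓ : Real.Gamma (β + 1 + k + 1) = (β + k + 1) * Real.Gamma (β + k + 1) := by
    rw [← Real.Gamma_add_one hpos.ne']; ring_nf
  have hG : ((k + j : ℕ) : ℝ) + (β + 1) + 1 = ((k + j + 1 : ℕ) : ℝ) + β + 1 := by
    push_cast; ring
  have h₁ : k + j - k = j := by omega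
  have h₂ : k + j + 1 - k = j + 1 := by omega
  have hΓ0 := (Real.Gamma_pos_of_pos hpos).ne'
  have hj : (j : ℝ) + 1 ≠ 0 := by positivity
  unfold genLaguerreTerm
  rw [hΓ, hG, h₁, h₂, Nat.factorial_succ]
  push_cast
  field_simp
  ring

theorem mul_genLaguerreTerm (β : ℝ) (m k : ℕ) (x : ℝ) :
    x * genLaguerreTerm (β + 1) m x k =
      -((k + 1 : ℕ) * genLaguerreTerm β (m + 1) x (k + 1)) := by
  have hΓ : β + ((k + 1 : ℕ) : ℝ) + 1 = β + 1 + k + 1 := by push_cast; ring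
  have hG : ((m + 1 : ℕ) : ℝ) + β + 1 = (m : ℝ) + (β + 1) + 1 := by push_cast; ring
  have hk : (k : ℝ) + 1 ≠ 0 := by positivity
  unfold genLaguerreTerm
  rw [hΓ, hG, Nat.add_sub_add_right, Nat.factorial_succ, pow_succ]
  push_cast
  field_simp

theorem sum_add_mul_genLaguerreTerm_sub {β : ℝ} (hβ : -1 < β) (m : ℕ) (x : ℝ) :
    ∑ k ∈ Finset.range (m + 1), (β + 1 + k) * genLaguerreTerm (β + 1) m x k -
      x * genLaguerre (β + 1) m x = (m + 1 : ℕ) * genLaguerre β (m + 1) x := by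
  have h₁ : ∑ k ∈ Finset.range (m + 1), (β + 1 + k) * genLaguerreTerm (β + 1) m x k =
      ∑ k ∈ Finset.range (m + 2), ((m + 1 : ℕ) - k : ℝ) * genLaguerreTerm β (m + 1) x k := by
    rw [Finset.sum_range_succ _ (m + 1), sub_self, zero_mul, add_zero]
    exact Finset.sum_congr rfl fun k hk =>
      add_mul_genLaguerreTerm hβ (Finset.mem_range_succ_iff.mp hk) x
  have h₂ : x * genLaguerre (β + 1) m x =
      -∑ k ∈ Finset.range (m + 2), (k : ℝ) * genLaguerreTerm β (m + 1) x k := by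
    rw [Finset.sum_range_succ' _ (m + 1), Nat.cast_zero, zero_mul, add_zero,
      genLaguerre_eq_sum_genLaguerreTerm, Finset.mul_sum, ← Finset.sum_neg_distrib]
    exact Finset.sum_congr rfl fun k _ => mul_genLaguerreTerm β m k x
  rw [h₁, h₂, sub_neg_eq_add, ← Finset.sum_add_distrib, genLaguerre_eq_sum_genLaguerreTerm,
    Finset.mul_sum]
  exact Finset.sum_congr rfl fun k _ => by ring

/-- For `β > -1`, `n ≥ 1` and `x > 0`, the derivative of
`x ↦ x^{β+1} e^{-x} L_{n-1}^{β+1}(x)` equals `n · x^{β} e^{-x} L_n^{β}(x)`. -/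
theorem hasDerivAt_rpow_mul_exp_mul_genLaguerre
    (β : ℝ) (hβ : -1 < β) (n : ℕ) (hn : 1 ≤ n) (x : ℝ) (hx : 0 < x) :
    HasDerivAt (fun y : ℝ => y ^ (β + 1) * Real.exp (-y) * genLaguerre (β + 1) (n - 1) y)
      (n * (x ^ β * Real.exp (-x) * genLaguerre β n x)) x := by
  obtain ⟨m, rfl⟩ := Nat.exists_eq_add_of_le' hn
  rw [Nat.add_sub_cancel]
  have h := ((Real.hasDerivAt_rpow_const (p := β + 1) (Or.inl hx.ne')).mul
    (hasDerivAt_neg x).exp).mul (hasDerivAt_genLaguerre (β + 1) m hx.ne')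
  refine h.congr_deriv ?_
  have hsum := sum_add_mul_genLaguerreTerm_sub hβ m x
  simp only [add_mul (β + 1), Finset.sum_add_distrib] at hsum
  rw [← Finset.mul_sum, ← genLaguerre_eq_sum_genLaguerreTerm] at hsum
  rw [mul_left_comm (↑(m + 1) : ℝ), ← hsum, ← Finset.sum_div, add_sub_cancel_right,
    Real.rpow_add_one hx.ne']
  simp only [Pi.mul_apply, Real.rpow_add_one hx.ne']
  field_simp
  ring
end

section
/- Let ν > 0 and λ ≥ 0 be real parameters and let r > 0. Then the non-central chi-square density satisfies Tiku's generalized Laguerre expansion: (e^{-(r+λ)/2}/2) · (r/λ)^{ν/4 - 1/2} · I_{ν/2-1}(√(λ r)) = (e^{-r/2}/2) · (r/2)^{ν/2-1} · Σ_{j=0}^∞ [(-λ/2)^j / Γ(ν/2 + j)] · L_j^{ν/2-1}(r/2), where for λ = 0 the left-hand side is interpreted by its limit, namely the central chi-square density (e^{-r/2}/2)·(r/2)^{ν/2-1}/Γ(ν/2), and the series on the right converges. -/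
open Real MeasureTheory

/-- The modified Bessel function of the first kind of real order `p`:
`I_p(z) = ∑_{m=0}^∞ (z/2)^{2m+p} / (m! · Γ(m+p+1))`. -/
noncomputable def besselI (p z : ℝ) : ℝ :=
  ∑' m : ℕ, (z / 2) ^ (2 * (m : ℝ) + p) / ((Nat.factorial m : ℝ) * Real.Gamma (m + p + 1))

/-- The non-central chi-square density, interpreted for `λ = 0` as the central
chi-square density. -/
noncomputable def noncentralChiSqPdf (ν lam r : ℝ) : ℝ :=
  if lam = 0 then Real.exp (-r / 2) / 2 * (r / 2) ^ (ν / 2 - 1) / Real.Gamma (ν / 2)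
  else Real.exp (-(r + lam) / 2) / 2 * (r / lam) ^ (ν / 4 - 1 / 2) *
    besselI (ν / 2 - 1) (Real.sqrt (lam * r))

theorem exists_pos_le_Gamma_add_nat {a : ℝ} (ha : 0 < a) :
    ∃ c : ℝ, 0 < c ∧ ∀ k : ℕ, c ≤ Real.Gamma (a + k) := by
  have h : ∀ k : ℕ, Real.Gamma (a + 1) ≤ Real.Gamma (a + (k + 1 : ℕ)) := by
    intro k
    induction k with
    | zero => simp
    | succ k ih =>
      have hk : (0 : ℝ) < a + (k + 1 : ℕ) := by positivity
      have hrec := Real.Gamma_add_one hk.ne'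
      have h1 : (1 : ℝ) ≤ a + (k + 1 : ℕ) := by
        push_cast
        linarith [(Nat.cast_nonneg k : (0 : ℝ) ≤ k)]
      rw [show a + ((k + 1 + 1 : ℕ) : ℝ) = a + (k + 1 : ℕ) + 1 by push_cast; ring, hrec]
      nlinarith [Real.Gamma_pos_of_pos hk]
  refine ⟨min (Real.Gamma a) (Real.Gamma (a + 1)),
    lt_min (Real.Gamma_pos_of_pos ha) (Real.Gamma_pos_of_pos (by linarith)), ?_⟩
  rintro (_ | k)
  · simp
  · exact (min_le_right _ _).trans (h k)

theorem summable_pow_div_factorial_mul_Gamma {a : ℝ} (ha : 0 < a) {t : ℝ} (ht : 0 ≤ t) :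
    Summable fun k : ℕ => t ^ k / ((Nat.factorial k : ℝ) * Real.Gamma (a + k)) := by
  obtain ⟨c, hc, hle⟩ := exists_pos_le_Gamma_add_nat ha
  refine Summable.of_nonneg_of_le (fun k => ?_) (fun k => ?_)
    ((Real.summable_pow_div_factorial t).div_const c)
  · have := hc.trans_le (hle k)
    positivity
  · rw [div_div]
    have := hle k
    gcongr

theorem genLaguerre_term_eq_sum_antidiagonal {a : ℝ} (ha : 0 < a) (x y : ℝ) (j : ℕ) :
    (-y) ^ j / Real.Gamma (a + j) * genLaguerre (a - 1) j x =
      ∑ kl ∈ Finset.HasAntidiagonal.antidiagonal j,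
        (x * y) ^ kl.1 / ((Nat.factorial kl.1 : ℝ) * Real.Gamma (a + kl.1)) *
          ((-y) ^ kl.2 / (Nat.factorial kl.2 : ℝ)) := by
  rw [genLaguerre, Finset.mul_sum, Finset.Nat.sum_antidiagonal_eq_sum_range_succ_mk]
  refine Finset.sum_congr rfl fun k hk => ?_
  obtain ⟨m, rfl⟩ := Nat.exists_eq_add_of_le (Nat.lt_succ_iff.mp (Finset.mem_range.mp hk))
  have hΓj : Real.Gamma (a + (k + m : ℕ)) ≠ 0 := (Real.Gamma_pos_of_pos (by positivity)).ne'
  have hΓk : Real.Gamma (a + k) ≠ 0 := (Real.Gamma_pos_of_pos (by positivity)).ne'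
  rw [show ((k + m : ℕ) : ℝ) + (a - 1) + 1 = a + (k + m : ℕ) by ring,
    show a - 1 + (k : ℝ) + 1 = a + k by ring, Nat.add_sub_cancel_left]
  have hpow : (-y) ^ (k + m) * (-x) ^ k = (y * x) ^ k * (-y) ^ m := by
    rw [pow_add, mul_right_comm, ← mul_pow, neg_mul_neg]
  field_simp
  exact hpow

theorem hasSum_genLaguerre {a : ℝ} (ha : 0 < a) {x y : ℝ} (hx : 0 ≤ x) (hy : 0 ≤ y) :
    HasSum (fun j : ℕ => (-y) ^ j / Real.Gamma (a + j) * genLaguerre (a - 1) j x)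
      ((∑' k : ℕ, (x * y) ^ k / ((Nat.factorial k : ℝ) * Real.Gamma (a + k))) *
        Real.exp (-y)) := by
  simp_rw [genLaguerre_term_eq_sum_antidiagonal ha]
  have hf := (summable_pow_div_factorial_mul_Gamma ha (mul_nonneg hx hy)).norm
  have hg := (Real.summable_pow_div_factorial (-y)).norm
  rw [Real.exp_eq_exp_ℝ, NormedSpace.exp_eq_tsum_div,
    tsum_mul_tsum_eq_tsum_sum_antidiagonal_of_summable_norm hf hg]
  exact (summable_norm_sum_mul_antidiagonal_of_summable_norm hf hg).of_norm.hasSum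

theorem besselI_two_mul_sqrt {t : ℝ} (ht : 0 < t) (p : ℝ) :
    besselI p (2 * √t) =
      t ^ (p / 2) * ∑' k : ℕ, t ^ k / ((Nat.factorial k : ℝ) * Real.Gamma (p + 1 + k)) := by
  rw [besselI, ← tsum_mul_left]
  refine tsum_congr fun k => ?_
  rw [mul_div_cancel_left₀ _ (two_ne_zero' ℝ), Real.sqrt_eq_rpow, ← Real.rpow_mul ht.le,
    show 1 / 2 * (2 * (k : ℝ) + p) = p / 2 + k by ring, Real.rpow_add ht, Real.rpow_natCast,
    show (k : ℝ) + p + 1 = p + 1 + k by ring, mul_div_assoc]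

theorem noncentralChiSqPdf_eq_tsum {ν lam r : ℝ} (hlam : 0 ≤ lam) (hr : 0 < r) :
    noncentralChiSqPdf ν lam r =
      Real.exp (-r / 2) / 2 * (r / 2) ^ (ν / 2 - 1) *
        ((∑' k : ℕ, (r / 2 * (lam / 2)) ^ k /
          ((Nat.factorial k : ℝ) * Real.Gamma (ν / 2 + k))) * Real.exp (-(lam / 2))) := by
  rw [noncentralChiSqPdf]
  split_ifs with h
  · subst h
    rw [tsum_eq_single 0 (fun k hk => by simp [hk])]
    simp [div_eq_mul_inv]
  · have hl : 0 < lam := lt_of_le_of_ne hlam (Ne.symm h)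
    have hsqrt : √(lam * r) = 2 * √(r / 2 * (lam / 2)) := by
      rw [show lam * r = 2 ^ 2 * (r / 2 * (lam / 2)) by ring,
        Real.sqrt_mul (by norm_num), Real.sqrt_sq (by norm_num)]
    have hexp : Real.exp (-(r + lam) / 2) = Real.exp (-r / 2) * Real.exp (-(lam / 2)) := by
      rw [← Real.exp_add]
      ring_nf
    have hpow : (r / lam) ^ (ν / 4 - 1 / 2) * (r / 2 * (lam / 2)) ^ ((ν / 2 - 1) / 2) =
        (r / 2) ^ (ν / 2 - 1) := by
      rw [show ν / 4 - 1 / 2 = (ν / 2 - 1) / 2 by ring,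
        ← Real.mul_rpow (by positivity) (by positivity),
        show r / lam * (r / 2 * (lam / 2)) = (r / 2) ^ (2 : ℝ) by
          rw [Real.rpow_two]; field_simp,
        ← Real.rpow_mul (by positivity), mul_div_cancel₀ _ (two_ne_zero' ℝ)]
    rw [hsqrt, besselI_two_mul_sqrt (by positivity), hexp, ← hpow, sub_add_cancel]
    ring

/-- Tiku's generalized Laguerre expansion of the non-central chi-square pdf:
for `ν > 0`, `λ ≥ 0` and `r > 0`, the series
`∑_{j=0}^∞ (-λ/2)^j / Γ(ν/2 + j) · L_j^{ν/2-1}(r/2)` converges and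
`f_{χ²_{ν,λ}}(r) = (e^{-r/2}/2) (r/2)^{ν/2-1} ∑_{j=0}^∞ (-λ/2)^j / Γ(ν/2+j) · L_j^{ν/2-1}(r/2)`. -/
theorem tiku_expansion (ν lam : ℝ) (hν : 0 < ν) (hlam : 0 ≤ lam) (r : ℝ) (hr : 0 < r) :
    Summable (fun j : ℕ =>
        (-lam / 2) ^ j / Real.Gamma (ν / 2 + j) * genLaguerre (ν / 2 - 1) j (r / 2)) ∧
      noncentralChiSqPdf ν lam r =
        Real.exp (-r / 2) / 2 * (r / 2) ^ (ν / 2 - 1) *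
          ∑' j : ℕ, (-lam / 2) ^ j / Real.Gamma (ν / 2 + j) *
            genLaguerre (ν / 2 - 1) j (r / 2) := by
  have h := hasSum_genLaguerre (half_pos hν) (half_pos hr).le (div_nonneg hlam zero_le_two)
  simp_rw [neg_div 2 lam]
  refine ⟨h.summable, ?_⟩
  rw [h.tsum_eq]
  exact noncentralChiSqPdf_eq_tsum hlam hr
end
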